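/- If A is an equational Artinian L-structure, then for every natural number n every closed set of the radical topology with respect to A on At_L(x₁,…,xₙ) is a finite union of A-radical ideals. -/

import Mathlib

open FirstOrder

/-- The solution set in `A` of a system `S` of equations in `n` variables. -/
def VSet (L : FirstOrder.Language) (A : Type*) [L.Structure A] {n : ℕ}
    (S : Set (L.Term (Fin n) × L.Term (Fin n))) : Set (Fin n → A) :=
  { a | ∀ pq ∈ S, pq.1.realize a = pq.2.realize a }

/-- A subset of `Aⁿ` is an algebraic set if it is the solution set of some system. -/
def IsAlgebraicSet (L : FirstOrder.Language) (A : Type*) [L.Structure A] {n : ℕ}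
    (Y : Set (Fin n → A)) : Prop :=
  ∃ S, Y = VSet L A S

/-- The radical of a subset `E ⊆ Aⁿ`. -/
def Rad (L : FirstOrder.Language) (A : Type*) [L.Structure A] {n : ℕ}
    (E : Set (Fin n → A)) : Set (L.Term (Fin n) × L.Term (Fin n)) :=
  { pq | ∀ a ∈ E, pq.1.realize a = pq.2.realize a }

/-- An `A`-radical ideal of the term algebra. -/
def IsRadicalIdeal (L : FirstOrder.Language) (A : Type*) [L.Structure A] {n : ℕ}
    (R : Set (L.Term (Fin n) × L.Term (Fin n))) : Prop :=
  ∃ E : Set (Fin n → A), R = Rad L A E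

/-- `A` is equational Artinian: every ascending chain of algebraic sets stabilizes. -/
def EquationalArtinian (L : FirstOrder.Language) (A : Type*) [L.Structure A] : Prop :=
  ∀ (n : ℕ) (Y : ℕ → Set (Fin n → A)),
    (∀ i, IsAlgebraicSet L A (Y i)) → (∀ i, Y i ⊆ Y (i + 1)) →
    ∃ N, ∀ m, N ≤ m → Y m = Y N

/-- The radical topology on atomic formulas: closed sets are arbitrary intersections of
finite unions of `A`-radical ideals. -/
def radicalTopology (L : FirstOrder.Language) (A : Type*) [L.Structure A] (n : ℕ) :
    TopologicalSpace (L.Term (Fin n) × L.Term (Fin n)) :=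
  TopologicalSpace.generateFrom { U | IsRadicalIdeal L A Uᶜ }

/-- The Zariski topology on `Aⁿ`: closed sets are arbitrary intersections of
finite unions of algebraic sets. -/
def zariskiTopology (L : FirstOrder.Language) (A : Type*) [L.Structure A] (n : ℕ) :
    TopologicalSpace (Fin n → A) :=
  TopologicalSpace.generateFrom { U | IsAlgebraicSet L A Uᶜ }

/-- `C` is a union of finitely many members of `F`. -/
def IsFiniteUnionOf {X : Type*} (F : Set (Set X)) (C : Set X) : Prop :=
  ∃ 𝒞 : Set (Set X), 𝒞.Finite ∧ (∀ R ∈ 𝒞, R ∈ F) ∧ C = ⋃₀ 𝒞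

namespace IsFiniteUnionOf

variable {X : Type*} {F : Set (Set X)}

theorem of_mem {R : Set X} (hR : R ∈ F) : IsFiniteUnionOf F R :=
  ⟨{R}, Set.finite_singleton R, by simpa using hR, by simp⟩

theorem empty : IsFiniteUnionOf F ∅ :=
  ⟨∅, Set.finite_empty, by simp, by simp⟩

theorem union {C D : Set X} (hC : IsFiniteUnionOf F C) (hD : IsFiniteUnionOf F D) :
    IsFiniteUnionOf F (C ∪ D) := by
  obtain ⟨𝒞, hfC, hC, rfl⟩ := hC
  obtain ⟨𝒟, hfD, hD, rfl⟩ := hD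
  exact ⟨𝒞 ∪ 𝒟, hfC.union hfD, fun R hR => hR.elim (hC R) (hD R), (Set.sUnion_union 𝒞 𝒟).symm⟩

theorem biUnion {ι : Type*} {s : Set ι} (hs : s.Finite) {C : ι → Set X}
    (hC : ∀ i ∈ s, IsFiniteUnionOf F (C i)) : IsFiniteUnionOf F (⋃ i ∈ s, C i) := by
  induction s, hs using Set.Finite.induction_on with
  | empty => simpa using empty
  | insert _ _ ih =>
    rw [Set.biUnion_insert]
    exact (hC _ (Set.mem_insert _ _)).union (ih fun i hi => hC i (Set.mem_insert_of_mem _ hi))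

/-- If `F` is closed under binary intersections and satisfies the descending chain condition,
then finite unions of members of `F` are closed under arbitrary intersections, relative to a
member of `F`. -/
theorem inter_sInter (hinter : ∀ R ∈ F, ∀ S ∈ F, R ∩ S ∈ F)
    (hwf : WellFounded fun R S : F => (R : Set X) ⊂ S) {𝒮 : Set (Set X)}
    (h𝒮 : ∀ C ∈ 𝒮, IsFiniteUnionOf F C) (R : F) : IsFiniteUnionOf F (R ∩ ⋂₀ 𝒮) := by
  induction R using hwf.induction with
  | _ R ih =>
  by_cases hR : (R : Set X) ⊆ ⋂₀ 𝒮
  · rw [Set.inter_eq_left.2 hR]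
    exact of_mem R.2
  · obtain ⟨C, hC, hRC⟩ : ∃ C ∈ 𝒮, ¬ (R : Set X) ⊆ C := by
      simpa [Set.subset_sInter_iff] using hR
    obtain ⟨𝒞, hfin, hF, hCeq⟩ := h𝒮 C hC
    have hdecomp : (R : Set X) ∩ ⋂₀ 𝒮 = ⋃ S ∈ 𝒞, (R ∩ S) ∩ ⋂₀ 𝒮 := by
      ext x
      simp only [Set.mem_iUnion, Set.mem_inter_iff]
      constructor
      · rintro ⟨hxR, hx⟩
        obtain ⟨S, hS, hxS⟩ := hCeq ▸ hx C hC
        exact ⟨S, hS, ⟨hxR, hxS⟩, hx⟩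
      · rintro ⟨S, -, ⟨hxR, -⟩, hx⟩
        exact ⟨hxR, hx⟩
    rw [hdecomp]
    refine biUnion hfin fun S hS => ih ⟨R ∩ S, hinter _ R.2 _ (hF S hS)⟩ ?_
    refine ⟨Set.inter_subset_left, fun h => hRC ?_⟩
    rw [hCeq]
    exact (h.trans Set.inter_subset_right).trans (Set.subset_sUnion_of_mem hS)

theorem of_isClosed_generateFrom (huniv : Set.univ ∈ F)
    (hinter : ∀ R ∈ F, ∀ S ∈ F, R ∩ S ∈ F)
    (hwf : WellFounded fun R S : F => (R : Set X) ⊂ S) {C : Set X}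
    (hC : @IsClosed _ (TopologicalSpace.generateFrom {U | Uᶜ ∈ F}) C) : IsFiniteUnionOf F C := by
  have key : ∀ U, TopologicalSpace.GenerateOpen {U | Uᶜ ∈ F} U → IsFiniteUnionOf F Uᶜ := by
    intro U hU
    induction hU with
    | basic U hU => exact of_mem hU
    | univ => simpa using empty
    | inter U V _ _ hU hV =>
      rw [Set.compl_inter]
      exact hU.union hV
    | sUnion 𝒰 _ ih =>
      have h := inter_sInter hinter hwf (Set.forall_mem_image.2 ih) ⟨Set.univ, huniv⟩
      rwa [Set.univ_inter, ← Set.compl_sUnion] at h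
  have hopen := (@isOpen_compl_iff _ _ (TopologicalSpace.generateFrom {U | Uᶜ ∈ F})).2 hC
  simpa using key Cᶜ hopen

end IsFiniteUnionOf

section Radical

variable {L : FirstOrder.Language} {A : Type*} [L.Structure A] {n : ℕ}

theorem rad_vSet_rad (E : Set (Fin n → A)) : Rad L A (VSet L A (Rad L A E)) = Rad L A E :=
  Set.Subset.antisymm (fun _ h a ha => h a fun _ hpq => hpq a ha) fun _ h _ ha => ha _ h

theorem IsRadicalIdeal.rad_vSet {R : Set (L.Term (Fin n) × L.Term (Fin n))}
    (hR : IsRadicalIdeal L A R) : Rad L A (VSet L A R) = R := by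
  obtain ⟨E, rfl⟩ := hR
  exact rad_vSet_rad E

theorem isRadicalIdeal_univ :
    IsRadicalIdeal L A (Set.univ : Set (L.Term (Fin n) × L.Term (Fin n))) :=
  ⟨∅, by simp [Rad]⟩

theorem IsRadicalIdeal.inter {R S : Set (L.Term (Fin n) × L.Term (Fin n))}
    (hR : IsRadicalIdeal L A R) (hS : IsRadicalIdeal L A S) : IsRadicalIdeal L A (R ∩ S) := by
  obtain ⟨E, rfl⟩ := hR
  obtain ⟨E', rfl⟩ := hS
  refine ⟨E ∪ E', ?_⟩
  ext pq
  simp only [Rad, Set.mem_inter_iff, Set.mem_ofPred_eq, Set.mem_union, or_imp, forall_and]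

theorem EquationalArtinian.wellFounded_radicalIdeal (hA : EquationalArtinian L A) (n : ℕ) :
    WellFounded fun R S : {R : Set (L.Term (Fin n) × L.Term (Fin n)) | IsRadicalIdeal L A R} =>
      (R : Set (L.Term (Fin n) × L.Term (Fin n))) ⊂ S := by
  refine wellFounded_iff_isEmpty_descending_chain.2 ⟨fun ⟨R, hR⟩ => ?_⟩
  obtain ⟨N, hN⟩ := hA n (fun i => VSet L A (R i : Set (L.Term (Fin n) × L.Term (Fin n))))
    (fun i => ⟨R i, rfl⟩) fun i _ ha pq hpq => ha pq ((hR i).1 hpq)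
  refine (hR N).ne ?_
  rw [← (R (N + 1)).2.rad_vSet, ← (R N).2.rad_vSet]
  exact congrArg (Rad L A) (hN (N + 1) N.le_succ)

end Radical

/-- if `A` is equational Artinian then every closed set of the radical
topology with respect to `A` is a finite union of `A`-radical ideals. -/
theorem closed_eq_finite_union_of_radicals
    {L : FirstOrder.Language} (A : Type*) [L.Structure A]
    (hL : ∀ k, IsEmpty (L.Relations k))
    (hA : EquationalArtinian L A) (n : ℕ)
    (C : Set (L.Term (Fin n) × L.Term (Fin n)))
    (hC : @IsClosed _ (radicalTopology L A n) C) :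
    ∃ 𝒞 : Set (Set (L.Term (Fin n) × L.Term (Fin n))),
      𝒞.Finite ∧ (∀ R ∈ 𝒞, IsRadicalIdeal L A R) ∧ C = ⋃₀ 𝒞 :=
  IsFiniteUnionOf.of_isClosed_generateFrom (F := {R | IsRadicalIdeal L A R}) isRadicalIdeal_univ
    (fun _ hR _ hS => IsRadicalIdeal.inter hR hS) (hA.wellFounded_radicalIdeal n) hC
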